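/- arXiv:2103.13533 — 4 statements merged into one kernel-verified Lean document; each statement's English description precedes it below -/
import Mathlib

section
/- Let i ≠ j be indices in {1,…,n}, let a < b be real numbers, and let γ : [0,1] → (a,b)ⁿ be a strictly monotonic continuously differentiable path with γᵢ(0) = γⱼ(0) and γᵢ(1) = γⱼ(1). Then the following are equivalent: (1) γᵢ(t) = γⱼ(t) for every t ∈ [0,1]; (2) for every Lipschitz continuous function F : (a,b)ⁿ → ℝ that is symmetric in xᵢ and xⱼ and differentiable at γ(t) for almost every t ∈ [0,1], one has ∫₀¹ (∂F/∂xᵢ)(γ(t)) γᵢ′(t) dt = ∫₀¹ (∂F/∂xⱼ)(γ(t)) γⱼ′(t) dt. -/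
open Set MeasureTheory

/-- A smooth step function, equal to `0` on `(-∞, c]` and to `1` on `[d, ∞)`. -/
noncomputable def smoothStep (c d s : ℝ) : ℝ :=
  Real.smoothTransition ((s - c) / (d - c))

lemma contDiff_smoothStep (c d : ℝ) : ContDiff ℝ 1 (smoothStep c d) := by
  have h : ContDiff ℝ 1 Real.smoothTransition := Real.smoothTransition.contDiff (n := 1)
  exact h.comp ((contDiff_id.sub contDiff_const).div_const _)

lemma smoothStep_of_le {c d s : ℝ} (hcd : c < d) (hs : s ≤ c) : smoothStep c d s = 0 :=
  Real.smoothTransition.zero_of_nonpos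
    (div_nonpos_of_nonpos_of_nonneg (by linarith) (by linarith))

lemma smoothStep_of_ge {c d s : ℝ} (hcd : c < d) (hs : d ≤ s) : smoothStep c d s = 1 :=
  Real.smoothTransition.one_of_one_le ((one_le_div (by linarith)).2 (by linarith))

lemma deriv_smoothStep_of_lt {c d s : ℝ} (hcd : c < d) (hs : s < c) :
    deriv (smoothStep c d) s = 0 := by
  have h : smoothStep c d =ᶠ[nhds s] fun _ => 0 := by
    filter_upwards [Iio_mem_nhds hs] with u hu using smoothStep_of_le hcd (mem_Iio.1 hu).le
  rw [h.deriv_eq, deriv_const]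

lemma deriv_smoothStep_of_gt {c d s : ℝ} (hcd : c < d) (hs : d < s) :
    deriv (smoothStep c d) s = 0 := by
  have h : smoothStep c d =ᶠ[nhds s] fun _ => 1 := by
    filter_upwards [Ioi_mem_nhds hs] with u hu using smoothStep_of_ge hcd (mem_Ioi.1 hu).le
  rw [h.deriv_eq, deriv_const]

lemma exists_lipschitzOnWith_box {n : ℕ} {F : EuclideanSpace ℝ (Fin n) → ℝ}
    (hF : ContDiff ℝ 1 F) (a b : ℝ) :
    ∃ K : NNReal, LipschitzOnWith K F {x : EuclideanSpace ℝ (Fin n) | ∀ k, x k ∈ Ioo a b} := by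
  have hc : IsCompact (WithLp.toLp 2 '' (univ.pi fun _ : Fin n => Icc a b) :
      Set (EuclideanSpace ℝ (Fin n))) :=
    (isCompact_univ_pi fun _ => isCompact_Icc).image (PiLp.continuous_toLp 2 _)
  obtain ⟨R, hR⟩ := hc.isBounded.subset_closedBall 0
  obtain ⟨K, hK⟩ := hF.contDiffOn.exists_lipschitzOnWith one_ne_zero
    (convex_closedBall (0 : EuclideanSpace ℝ (Fin n)) R) (isCompact_closedBall _ _)
  exact ⟨K, hK.mono fun x hx =>
    hR ⟨WithLp.ofLp x, fun k _ => Ioo_subset_Icc_self (hx k), rfl⟩⟩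

lemma isOpen_box {n : ℕ} (a b : ℝ) :
    IsOpen {x : EuclideanSpace ℝ (Fin n) | ∀ k, x k ∈ Ioo a b} := by
  simp only [ofPred_forall]
  exact isOpen_iInter_of_finite fun k => isOpen_Ioo.preimage (EuclideanSpace.proj k).continuous

/-- On the diagonal, the two partial derivatives of a function symmetric in two variables agree. -/
lemma fderiv_single_eq_of_symmetric {n : ℕ} {i j : Fin n} {a b : ℝ}
    {F : EuclideanSpace ℝ (Fin n) → ℝ}
    (hsymm : ∀ x : EuclideanSpace ℝ (Fin n), (∀ k, x k ∈ Ioo a b) →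
      F (WithLp.toLp 2 (fun k => x (Equiv.swap i j k))) = F x)
    {x : EuclideanSpace ℝ (Fin n)} (hx : ∀ k, x k ∈ Ioo a b) (hxij : x i = x j) :
    fderiv ℝ F x (EuclideanSpace.single i 1) = fderiv ℝ F x (EuclideanSpace.single j 1) := by
  let L := LinearIsometryEquiv.piLpCongrLeft 2 ℝ ℝ (Equiv.swap i j)
  have hL : ∀ y, L y = WithLp.toLp 2 (fun k => y (Equiv.swap i j k)) := fun y => by
    ext k
    simp [L, LinearIsometryEquiv.piLpCongrLeft_apply]
  have hLx : L x = x := by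
    rw [hL]
    ext k
    rcases eq_or_ne k i with rfl | hi
    · simp [hxij]
    rcases eq_or_ne k j with rfl | hj
    · simp [hxij]
    simp [Equiv.swap_apply_of_ne_of_ne hi hj]
  have hev : F ∘ L =ᶠ[nhds x] F := by
    filter_upwards [(isOpen_box a b).mem_nhds hx] with y hy
    rw [Function.comp_apply, hL, hsymm y hy]
  have hd : fderiv ℝ F x = (fderiv ℝ F x).comp (L : _ →L[ℝ] EuclideanSpace ℝ (Fin n)) := by
    conv_lhs => rw [← hev.fderiv_eq]
    have := L.toContinuousLinearEquiv.comp_right_fderiv (f := F) (x := x)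
    simpa [hLx] using this
  have hs : L (EuclideanSpace.single i 1) = EuclideanSpace.single j 1 := by
    simp [L]
  conv_lhs => rw [hd]
  simp [hs]

lemma fderiv_mul_coord {n : ℕ} {φ : ℝ → ℝ} (hφ : Differentiable ℝ φ) (i j : Fin n)
    (x v : EuclideanSpace ℝ (Fin n)) :
    fderiv ℝ (fun y : EuclideanSpace ℝ (Fin n) => φ (y i) * φ (y j)) x v =
      φ (x i) * (deriv φ (x j) * v j) + φ (x j) * (deriv φ (x i) * v i) := by
  have h : ∀ k : Fin n, HasFDerivAt (fun y : EuclideanSpace ℝ (Fin n) => φ (y k))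
      (deriv φ (x k) • (EuclideanSpace.proj k : EuclideanSpace ℝ (Fin n) →L[ℝ] ℝ)) x := fun k =>
    (hφ (x k)).hasDerivAt.comp_hasFDerivAt x
      (EuclideanSpace.proj k : EuclideanSpace ℝ (Fin n) →L[ℝ] ℝ).hasFDerivAt
  have hm : HasFDerivAt (fun y : EuclideanSpace ℝ (Fin n) => φ (y i) * φ (y j)) _ x :=
    (h i).mul (h j)
  rw [hm.fderiv]
  simp

/-- A path that is off the diagonal at some time does not preserve symmetry. -/
lemma exists_symmetric_integral_ne {n : ℕ} {i j : Fin n} (hij : i ≠ j) (a b : ℝ)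
    {γ : ℝ → EuclideanSpace ℝ (Fin n)} (hγ : ContDiffOn ℝ 1 γ (Icc (0:ℝ) 1))
    (hmono : ∀ k : Fin n, StrictMonoOn (fun t => γ t k) (Icc (0:ℝ) 1) ∨
      StrictAntiOn (fun t => γ t k) (Icc (0:ℝ) 1))
    (h0 : γ 0 i = γ 0 j) (h1 : γ 1 i = γ 1 j)
    {t₀ : ℝ} (ht₀ : t₀ ∈ Icc (0:ℝ) 1) (hlt : γ t₀ i < γ t₀ j) :
    ∃ F : EuclideanSpace ℝ (Fin n) → ℝ,
      (∃ K : NNReal, LipschitzOnWith K F {x : EuclideanSpace ℝ (Fin n) | ∀ k, x k ∈ Ioo a b}) ∧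
      (∀ x : EuclideanSpace ℝ (Fin n),
        F (WithLp.toLp 2 (fun k => x (Equiv.swap i j k))) = F x) ∧
      Differentiable ℝ F ∧
      ∫ t in (0:ℝ)..1,
          fderiv ℝ F (γ t) (EuclideanSpace.single i 1) * derivWithin (fun s => γ s i) (Icc (0:ℝ) 1) t
        ≠ ∫ t in (0:ℝ)..1,
          fderiv ℝ F (γ t) (EuclideanSpace.single j 1) *
            derivWithin (fun s => γ s j) (Icc (0:ℝ) 1) t := by
  set c := γ t₀ i
  set d := γ t₀ j
  have h0m : (0:ℝ) ∈ Icc (0:ℝ) 1 := ⟨le_rfl, zero_le_one⟩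
  have h1m : (1:ℝ) ∈ Icc (0:ℝ) 1 := ⟨zero_le_one, le_rfl⟩
  have key : (∀ s ∈ Icc (0:ℝ) 1, γ s i < c ↔ γ s j < d) ∧
      smoothStep c d (γ 1 i) ≠ smoothStep c d (γ 0 i) := by
    rcases hmono i with hi | hi <;> rcases hmono j with hj | hj
    · refine ⟨fun s hs => (hi.lt_iff_lt hs ht₀).trans (hj.lt_iff_lt hs ht₀).symm, ?_⟩
      rw [smoothStep_of_le hlt (hi.monotoneOn h0m ht₀ ht₀.1), h1,
        smoothStep_of_ge hlt (hj.monotoneOn ht₀ h1m ht₀.2)]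
      exact one_ne_zero
    · have := hi h0m h1m one_pos
      have := hj h0m h1m one_pos
      simp only at *
      linarith
    · have := hi h0m h1m one_pos
      have := hj h0m h1m one_pos
      simp only at *
      linarith
    · refine ⟨fun s hs => (hi.lt_iff_gt hs ht₀).trans (hj.lt_iff_gt hs ht₀).symm, ?_⟩
      rw [smoothStep_of_le hlt (hi.antitoneOn ht₀ h1m ht₀.2), h0,
        smoothStep_of_ge hlt (hj.antitoneOn h0m ht₀ ht₀.1)]
      exact zero_ne_one
  have keyle : ∀ s ∈ Icc (0:ℝ) 1, γ s j ≤ d → γ s i ≤ c := fun s hs h => by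
    rcases hmono i with hi | hi <;> rcases hmono j with hj | hj
    · exact (hi.le_iff_le hs ht₀).2 ((hj.le_iff_le hs ht₀).1 h)
    · have := hi h0m h1m one_pos
      have := hj h0m h1m one_pos
      simp only at *
      linarith
    · have := hi h0m h1m one_pos
      have := hj h0m h1m one_pos
      simp only at *
      linarith
    · exact (hi.le_iff_ge hs ht₀).2 ((hj.le_iff_ge hs ht₀).1 h)
  have hφ := contDiff_smoothStep c d
  have hφd : Differentiable ℝ (smoothStep c d) := hφ.differentiable one_ne_zero
  have hproj : ∀ k : Fin n,
      ContDiff ℝ 1 (fun y : EuclideanSpace ℝ (Fin n) => y k) := fun k =>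
    (EuclideanSpace.proj k : EuclideanSpace ℝ (Fin n) →L[ℝ] ℝ).contDiff
  have hF : ContDiff ℝ 1 (fun y : EuclideanSpace ℝ (Fin n) =>
      smoothStep c d (y i) * smoothStep c d (y j)) :=
    (hφ.comp (hproj i)).mul (hφ.comp (hproj j))
  have hγi : ContDiffOn ℝ 1 (fun s => γ s i) (Icc (0:ℝ) 1) := (hproj i).comp_contDiffOn hγ
  refine ⟨_, exists_lipschitzOnWith_box hF a b, fun x => by simp [mul_comm],
    hF.differentiable one_ne_zero, ?_⟩
  have hI : ∫ t in (0:ℝ)..1, fderiv ℝ (fun y : EuclideanSpace ℝ (Fin n) =>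
        smoothStep c d (y i) * smoothStep c d (y j)) (γ t) (EuclideanSpace.single i 1) *
          derivWithin (fun s => γ s i) (Icc (0:ℝ) 1) t =
      smoothStep c d (γ 1 i) - smoothStep c d (γ 0 i) := by
    rw [← intervalIntegral.integral_derivWithin_Icc_of_contDiffOn_Icc
      (f := fun s => smoothStep c d (γ s i)) (hφ.comp_contDiffOn hγi) zero_le_one]
    refine intervalIntegral.integral_congr fun s hs => ?_
    rw [uIcc_of_le zero_le_one] at hs
    have hchain : derivWithin (fun s => smoothStep c d (γ s i)) (Icc (0:ℝ) 1) s =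
        deriv (smoothStep c d) (γ s i) * derivWithin (fun s => γ s i) (Icc (0:ℝ) 1) s :=
      (HasDerivAt.comp_hasDerivWithinAt (h₂ := smoothStep c d) (h := fun s => γ s i) s
        (hφd (γ s i)).hasDerivAt
        ((hγi.differentiableOn one_ne_zero s hs).hasDerivWithinAt)).derivWithin
        (uniqueDiffOn_Icc zero_lt_one s hs)
    simp only [fderiv_mul_coord hφd, hchain]
    rcases lt_or_ge (γ s i) c with h | h
    · simp [deriv_smoothStep_of_lt hlt h, hij.symm]
    · have : d ≤ γ s j := not_lt.1 fun h' => h.not_gt (((key.1 s hs).2 h'))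
      simp [smoothStep_of_ge hlt this, hij.symm]
  have hJ : ∫ t in (0:ℝ)..1, fderiv ℝ (fun y : EuclideanSpace ℝ (Fin n) =>
        smoothStep c d (y i) * smoothStep c d (y j)) (γ t) (EuclideanSpace.single j 1) *
          derivWithin (fun s => γ s j) (Icc (0:ℝ) 1) t = 0 := by
    refine (intervalIntegral.integral_congr fun s hs => ?_).trans intervalIntegral.integral_zero
    rw [uIcc_of_le zero_le_one] at hs
    simp only [fderiv_mul_coord hφd]
    rcases le_or_gt (γ s j) d with h | h
    · simp [smoothStep_of_le hlt (keyle s hs h), hij]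
    · simp [deriv_smoothStep_of_gt hlt h, hij]
  rw [hI, hJ]
  exact sub_ne_zero.2 key.2

/-- **Symmetry-preservation characterization for strictly monotonic paths (Theorem 1).**
Let `i ≠ j`, `a < b`, and let `γ : [0,1] → (a,b)ⁿ` be a strictly monotonic continuously
differentiable path with `γᵢ(0) = γⱼ(0)` and `γᵢ(1) = γⱼ(1)`.  Then `γᵢ = γⱼ` on `[0,1]`
iff for every Lipschitz continuous `F : (a,b)ⁿ → ℝ` symmetric in `xᵢ, xⱼ` and
differentiable at `γ t` for a.e. `t`, the line integrals
`∫₀¹ (∂F/∂xᵢ)(γ(t)) γᵢ'(t) dt` and `∫₀¹ (∂F/∂xⱼ)(γ(t)) γⱼ'(t) dt` coincide. -/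
theorem symmetry_preserving_iff_diagonal {n : ℕ} (i j : Fin n) (hij : i ≠ j)
    (a b : ℝ) (hab : a < b)
    (γ : ℝ → EuclideanSpace ℝ (Fin n))
    (hγbox : ∀ t ∈ Icc (0:ℝ) 1, ∀ k, γ t k ∈ Ioo a b)
    (hγ : ContDiffOn ℝ 1 γ (Icc (0:ℝ) 1))
    (hmono : ∀ k : Fin n, StrictMonoOn (fun t => γ t k) (Icc (0:ℝ) 1) ∨
      StrictAntiOn (fun t => γ t k) (Icc (0:ℝ) 1))
    (h0 : γ 0 i = γ 0 j) (h1 : γ 1 i = γ 1 j) :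
    (∀ t ∈ Icc (0:ℝ) 1, γ t i = γ t j) ↔
    (∀ F : EuclideanSpace ℝ (Fin n) → ℝ,
      (∃ K : NNReal, LipschitzOnWith K F {x : EuclideanSpace ℝ (Fin n) | ∀ k, x k ∈ Ioo a b}) →
      (∀ x : EuclideanSpace ℝ (Fin n), (∀ k, x k ∈ Ioo a b) →
        F (WithLp.toLp 2 (fun k => x (Equiv.swap i j k))) = F x) →
      (∀ᵐ t ∂(volume.restrict (Icc (0:ℝ) 1)), DifferentiableAt ℝ F (γ t)) →
      ∫ t in (0:ℝ)..1,
          fderiv ℝ F (γ t) (EuclideanSpace.single i 1) * derivWithin (fun s => γ s i) (Icc (0:ℝ) 1) t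
        = ∫ t in (0:ℝ)..1,
          fderiv ℝ F (γ t) (EuclideanSpace.single j 1) * derivWithin (fun s => γ s j) (Icc (0:ℝ) 1) t) := by
  refine ⟨fun hdiag F _ hsymm _ => ?_, fun H t ht => ?_⟩
  · refine intervalIntegral.integral_congr fun t ht => ?_
    rw [uIcc_of_le zero_le_one] at ht
    have hd : derivWithin (fun s => γ s i) (Icc (0:ℝ) 1) t =
        derivWithin (fun s => γ s j) (Icc (0:ℝ) 1) t :=
      derivWithin_congr hdiag (hdiag t ht)
    simp only [hd, fderiv_single_eq_of_symmetric hsymm (hγbox t ht) (hdiag t ht)]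
  · by_contra hne
    rcases lt_or_gt_of_ne hne with hlt | hlt
    · obtain ⟨F, hLip, hsymm, hdiff, hI⟩ :=
        exists_symmetric_integral_ne hij a b hγ hmono h0 h1 ht hlt
      exact hI (H F hLip (fun x _ => hsymm x) (.of_forall fun s => hdiff (γ s)))
    · obtain ⟨F, hLip, hsymm, hdiff, hI⟩ :=
        exists_symmetric_integral_ne hij.symm a b hγ hmono h0.symm h1.symm ht hlt
      rw [Equiv.swap_comm] at hsymm
      exact hI (H F hLip (fun x _ => hsymm x) (.of_forall fun s => hdiff (γ s))).symm
end

section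
/- Let i ≠ j be indices in {1,…,n}, let U ⊆ ℝⁿ be open, and let γ : [0,1] → U be a continuously differentiable path with γᵢ(t) = γⱼ(t) for every t ∈ [0,1]. Then for every Lipschitz continuous function F : U → ℝ that is symmetric in xᵢ and xⱼ and differentiable at γ(t) for almost every t ∈ [0,1], one has ∫₀¹ (∂F/∂xᵢ)(γ(t)) γᵢ′(t) dt = ∫₀¹ (∂F/∂xⱼ)(γ(t)) γⱼ′(t) dt. -/
open Set MeasureTheory

/-- If `F` is invariant near `x` under swapping the coordinates `i` and `j`, and `x i = x j`, then
the partial derivatives of `F` at `x` in the directions `i` and `j` agree. -/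
theorem fderiv_single_eq_of_swap_symmetric {n : ℕ} {i j : Fin n}
    {U : Set (EuclideanSpace ℝ (Fin n))} (hU : IsOpen U) {F : EuclideanSpace ℝ (Fin n) → ℝ}
    (hF : ∀ x : EuclideanSpace ℝ (Fin n), x ∈ U →
      (WithLp.toLp 2 (fun k => x (Equiv.swap i j k)) : EuclideanSpace ℝ (Fin n)) ∈ U →
      F (WithLp.toLp 2 (fun k => x (Equiv.swap i j k))) = F x)
    {x : EuclideanSpace ℝ (Fin n)} (hx : x ∈ U) (hxij : x i = x j) :
    fderiv ℝ F x (EuclideanSpace.single i 1) = fderiv ℝ F x (EuclideanSpace.single j 1) := by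
  let σ := LinearIsometryEquiv.piLpCongrLeft 2 ℝ ℝ (Equiv.swap i j)
  have hσ (y : EuclideanSpace ℝ (Fin n)) :
      σ y = WithLp.toLp 2 (fun k => y (Equiv.swap i j k)) := by
    ext k
    simp [σ, LinearIsometryEquiv.piLpCongrLeft_apply, Equiv.piCongrLeft', Equiv.symm_swap]
  have hσx : σ x = x := by
    rw [hσ]
    ext k
    change x (Equiv.swap i j k) = x k
    rcases eq_or_ne k i with rfl | hki
    · rw [Equiv.swap_apply_left, hxij]
    rcases eq_or_ne k j with rfl | hkj
    · rw [Equiv.swap_apply_right, hxij]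
    · rw [Equiv.swap_apply_of_ne_of_ne hki hkj]
  have hUσ : ∀ᶠ y in nhds x, σ y ∈ U :=
    σ.continuous.continuousAt.preimage_mem_nhds (hU.mem_nhds (by rwa [hσx]))
  have hFσ : F ∘ σ =ᶠ[nhds x] F := by
    filter_upwards [hU.mem_nhds hx, hUσ] with y hy hσy
    rw [hσ] at hσy
    rw [Function.comp_apply, hσ, hF y hy hσy]
  have hfderiv := σ.toContinuousLinearEquiv.comp_right_fderiv (f := F) (x := x)
  have hsingle : σ (EuclideanSpace.single i 1) = EuclideanSpace.single j 1 := by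
    simp [σ]
  change fderiv ℝ (F ∘ σ) x = (fderiv ℝ F (σ x)).comp _ at hfderiv
  rw [hFσ.fderiv_eq, hσx] at hfderiv
  rw [← hsingle]
  exact DFunLike.congr_fun hfderiv _

/-- If `γ : [0,1] → U` is a continuously differentiable path with `γᵢ = γⱼ` on `[0,1]`
(`i ≠ j`, `U` open), then for every Lipschitz continuous `F : U → ℝ` symmetric in
`xᵢ, xⱼ` and differentiable at `γ t` for a.e. `t`, the two line-integral attributions
coincide: `∫₀¹ (∂F/∂xᵢ)(γ(t)) γᵢ'(t) dt = ∫₀¹ (∂F/∂xⱼ)(γ(t)) γⱼ'(t) dt`. -/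
theorem diagonal_path_symmetry_preserving {n : ℕ} (i j : Fin n) (hij : i ≠ j)
    (U : Set (EuclideanSpace ℝ (Fin n))) (hU : IsOpen U)
    (γ : ℝ → EuclideanSpace ℝ (Fin n))
    (hγU : ∀ t ∈ Icc (0:ℝ) 1, γ t ∈ U)
    (hγ : ContDiffOn ℝ 1 γ (Icc (0:ℝ) 1))
    (hdiag : ∀ t ∈ Icc (0:ℝ) 1, γ t i = γ t j) :
    ∀ F : EuclideanSpace ℝ (Fin n) → ℝ,
      (∃ K : NNReal, LipschitzOnWith K F U) →
      (∀ x : EuclideanSpace ℝ (Fin n), x ∈ U →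
        (WithLp.toLp 2 (fun k => x (Equiv.swap i j k)) : EuclideanSpace ℝ (Fin n)) ∈ U →
        F (WithLp.toLp 2 (fun k => x (Equiv.swap i j k))) = F x) →
      (∀ᵐ t ∂(volume.restrict (Icc (0:ℝ) 1)), DifferentiableAt ℝ F (γ t)) →
      ∫ t in (0:ℝ)..1,
          fderiv ℝ F (γ t) (EuclideanSpace.single i 1) * derivWithin (fun s => γ s i) (Icc (0:ℝ) 1) t
        = ∫ t in (0:ℝ)..1,
          fderiv ℝ F (γ t) (EuclideanSpace.single j 1) * derivWithin (fun s => γ s j) (Icc (0:ℝ) 1) t := by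
  rintro F - hF -
  refine intervalIntegral.integral_congr fun t ht => ?_
  rw [uIcc_of_le zero_le_one] at ht
  rw [fderiv_single_eq_of_swap_symmetric hU hF (hγU t ht) (hdiag t ht),
    derivWithin_congr hdiag (hdiag t ht)]
end

section
/- Let i ≠ j be indices in {1,…,n}, let a < b be real numbers, and let γ : [0,1] → (a,b)ⁿ be a strictly monotonic continuously differentiable path with γᵢ(0) = γⱼ(0) and γᵢ(1) = γⱼ(1). If there exists t₀ ∈ (0,1) with γᵢ(t₀) ≠ γⱼ(t₀), then there exists a Lipschitz continuous function F : (a,b)ⁿ → ℝ that is symmetric in xᵢ and xⱼ, differentiable at γ(t) for almost every t ∈ [0,1], and satisfies ∫₀¹ (∂F/∂xᵢ)(γ(t)) γᵢ′(t) dt ≠ ∫₀¹ (∂F/∂xⱼ)(γ(t)) γⱼ′(t) dt. -/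
open Set MeasureTheory

/-- For `u ≤ v` there is a `C¹` function with nonnegative derivative which is positive on `(u, v)`
and vanishes outside of it. -/
lemma exists_contDiff_deriv_pos_Ioo {u v : ℝ} (huv : u ≤ v) :
    ∃ C : ℝ → ℝ, ContDiff ℝ 1 C ∧ (∀ x, 0 ≤ deriv C x) ∧ (∀ x ∈ Ioo u v, 0 < deriv C x) ∧
      (∀ x, x ≤ u → deriv C x = 0) ∧ (∀ x, v ≤ x → deriv C x = 0) := by
  let c : ℝ → ℝ := fun x => max 0 ((x - u) * (v - x))
  have hc : Continuous c := by fun_prop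
  have hd : ∀ x, HasDerivAt (fun y => ∫ z in u..y, c z) (c x) x := fun x =>
    intervalIntegral.integral_hasDerivAt_right (hc.intervalIntegrable _ _)
      (hc.stronglyMeasurableAtFilter _ _) hc.continuousAt
  have hderiv : deriv (fun y => ∫ z in u..y, c z) = c := funext fun x => (hd x).deriv
  refine ⟨fun y => ∫ z in u..y, c z, ?_, ?_, ?_, ?_, ?_⟩
  · rw [contDiff_one_iff_deriv, hderiv]
    exact ⟨fun x => (hd x).differentiableAt, hc⟩
  · intro x
    rw [hderiv]
    exact le_max_left _ _
  · intro x hx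
    rw [hderiv]
    exact lt_max_of_lt_right (mul_pos (sub_pos.2 hx.1) (sub_pos.2 hx.2))
  · intro x hx
    rw [hderiv]
    exact max_eq_left (mul_nonpos_of_nonpos_of_nonneg (by linarith) (by linarith))
  · intro x hx
    rw [hderiv]
    exact max_eq_left (mul_nonpos_of_nonneg_of_nonpos (by linarith) (by linarith))

/-- Around a point where `q < p` there is a maximal interval on which `q < p`. -/
lemma exists_excursion_interval {p q : ℝ → ℝ} (hp : ContinuousOn p (Icc 0 1))
    (hq : ContinuousOn q (Icc 0 1)) (h0 : p 0 = q 0) (h1 : p 1 = q 1)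
    {t₀ : ℝ} (ht₀ : t₀ ∈ Ioo (0 : ℝ) 1) (hlt : q t₀ < p t₀) :
    ∃ s t, 0 ≤ s ∧ s < t ∧ t ≤ 1 ∧ p s = q s ∧ p t = q t ∧ ∀ x ∈ Ioo s t, q x < p x := by
  have hd : ContinuousOn (fun x => p x - q x) (Icc 0 1) := hp.sub hq
  have hclosed : IsCompact (Icc (0 : ℝ) 1 ∩ (fun x => p x - q x) ⁻¹' {0}) :=
    isCompact_Icc.of_isClosed_subset (hd.preimage_isClosed_of_isClosed isClosed_Icc
      isClosed_singleton) inter_subset_left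
  obtain ⟨s, ⟨⟨⟨hs0, hs1⟩, hs⟩, hst⟩, hsmax⟩ :=
    (hclosed.inter_right (isClosed_Iic (a := t₀))).exists_isGreatest
      ⟨0, ⟨⟨le_rfl, zero_le_one⟩, by simp [h0]⟩, ht₀.1.le⟩
  obtain ⟨t, ⟨⟨⟨ht0, ht1⟩, ht⟩, htt⟩, htmin⟩ :=
    (hclosed.inter_right (isClosed_Ici (a := t₀))).exists_isLeast
      ⟨1, ⟨⟨zero_le_one, le_rfl⟩, by simp [h1]⟩, ht₀.2.le⟩
  simp only [mem_preimage, mem_singleton_iff, mem_Iic, mem_Ici] at hs ht hst htt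
  have hs' : s < t₀ := lt_of_le_of_ne hst (by rintro rfl; linarith)
  have ht' : t₀ < t := lt_of_le_of_ne htt (by rintro rfl; linarith)
  refine ⟨s, t, hs0, hs'.trans ht', ht1, by linarith, by linarith, fun x hx => ?_⟩
  by_contra! hle
  rcases le_total x t₀ with hx' | hx'
  · obtain ⟨y, hy, hy0⟩ := intermediate_value_Icc hx'
      (hd.mono (Icc_subset_Icc (hs0.trans hx.1.le) ht₀.2.le))
      (show (0 : ℝ) ∈ _ from ⟨by simpa using hle, by simpa using hlt.le⟩)
    have := hsmax ⟨⟨⟨by linarith [hx.1, hy.1], by linarith [hy.2, ht₀.2]⟩, hy0⟩, hy.2⟩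
    linarith [hx.1, hy.1]
  · obtain ⟨y, hy, hy0⟩ := intermediate_value_Icc' hx'
      (hd.mono (Icc_subset_Icc ht₀.1.le (hx.2.le.trans ht1)))
      (show (0 : ℝ) ∈ _ from ⟨by simpa using hle, by simpa using hlt.le⟩)
    have := htmin ⟨⟨⟨by linarith [hy.1, ht₀.1], by linarith [hx.2, hy.2]⟩, hy0⟩, hy.1⟩
    linarith [hx.2, hy.2]

/-- If two increasing paths share endpoints but `q t₀ < p t₀`, then some function of the form
`(x, y) ↦ C x * C y` has different line integrals in the two coordinates along `(p, q)`. -/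
lemma exists_contDiff_integral_ne_of_lt {p q : ℝ → ℝ} (hp : ContDiffOn ℝ 1 p (Icc 0 1))
    (hq : ContDiffOn ℝ 1 q (Icc 0 1)) (hpm : StrictMonoOn p (Icc 0 1))
    (hqm : StrictMonoOn q (Icc 0 1)) (h0 : p 0 = q 0) (h1 : p 1 = q 1)
    {t₀ : ℝ} (ht₀ : t₀ ∈ Ioo (0 : ℝ) 1) (hlt : q t₀ < p t₀) :
    ∃ C : ℝ → ℝ, ContDiff ℝ 1 C ∧
      ∫ t in (0 : ℝ)..1, deriv C (p t) * C (q t) * derivWithin p (Icc 0 1) t ≠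
      ∫ t in (0 : ℝ)..1, deriv C (q t) * C (p t) * derivWithin q (Icc 0 1) t := by
  obtain ⟨s, t, hs0, hst, ht1, hs, ht, hpq⟩ :=
    exists_excursion_interval hp.continuousOn hq.continuousOn h0 h1 ht₀ hlt
  have hsm : s ∈ Icc (0 : ℝ) 1 := ⟨hs0, hst.le.trans ht1⟩
  have htm : t ∈ Icc (0 : ℝ) 1 := ⟨hs0.trans hst.le, ht1⟩
  have huv : p s < p t := hpm hsm htm hst
  obtain ⟨C, hC, hC0, hCpos, hCl, hCr⟩ := exists_contDiff_deriv_pos_Ioo huv.le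
  have hCd : Differentiable ℝ C := hC.differentiable one_ne_zero
  have hC' : Continuous (deriv C) := hC.continuous_deriv le_rfl
  have hCc : Continuous C := hC.continuous
  have hCmono : Monotone C := monotone_of_deriv_nonneg hCd hC0
  have hCstrict : StrictMonoOn C (Icc (p s) (p t)) :=
    strictMonoOn_of_deriv_pos (convex_Icc _ _) hCc.continuousOn
      (by rw [interior_Icc]; exact hCpos)
  refine ⟨C, hC, fun heq => ?_⟩
  have hpc := hp.continuousOn
  have hqc := hq.continuousOn
  have hp'c : ContinuousOn (derivWithin p (Icc 0 1)) (Icc 0 1) :=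
    hp.continuousOn_derivWithin (uniqueDiffOn_Icc zero_lt_one) le_rfl
  have hq'c : ContinuousOn (derivWithin q (Icc 0 1)) (Icc 0 1) :=
    hq.continuousOn_derivWithin (uniqueDiffOn_Icc zero_lt_one) le_rfl
  have hp'0 : ∀ x, 0 ≤ derivWithin p (Icc 0 1) x := fun x => hpm.monotoneOn.derivWithin_nonneg
  have hq'0 : ∀ x, 0 ≤ derivWithin q (Icc 0 1) x := fun x => hqm.monotoneOn.derivWithin_nonneg
  have hderiv : ∀ {f : ℝ → ℝ}, ContDiffOn ℝ 1 f (Icc 0 1) → ∀ x ∈ Ioo (0 : ℝ) 1,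
      HasDerivAt (fun y => C (f y)) (deriv C (f x) * derivWithin f (Icc 0 1) x) x := by
    intro f hf x hx
    have h := ((hf.differentiableOn one_ne_zero) x (Ioo_subset_Icc_self hx)).hasDerivWithinAt
    exact (hCd (f x)).hasDerivAt.comp x (h.hasDerivAt (Icc_mem_nhds hx.1 hx.2))
  set p' := derivWithin p (Icc 0 1)
  set q' := derivWithin q (Icc 0 1)
  have hCp : ContinuousOn (fun x => C (p x)) (Icc 0 1) := hCc.comp_continuousOn hpc
  have hCq : ContinuousOn (fun x => C (q x)) (Icc 0 1) := hCc.comp_continuousOn hqc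
  have hC'p : ContinuousOn (fun x => deriv C (p x)) (Icc 0 1) := hC'.comp_continuousOn hpc
  have hC'q : ContinuousOn (fun x => deriv C (q x)) (Icc 0 1) := hC'.comp_continuousOn hqc
  let g : ℝ → ℝ := fun x => (C (p x) - C (q x)) * (deriv C (p x) * p' x + deriv C (q x) * q' x)
  have hgc : ContinuousOn g (Icc 0 1) :=
    (hCp.sub hCq).mul ((hC'p.mul hp'c).add (hC'q.mul hq'c))
  have hintegrable : ∀ {f : ℝ → ℝ}, ContinuousOn f (Icc 0 1) → IntervalIntegrable f volume 0 1 :=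
    fun hf => hf.intervalIntegrable_of_Icc zero_le_one
  have hi3 : IntervalIntegrable (fun x => C (p x) * (deriv C (p x) * p' x)
      - C (q x) * (deriv C (q x) * q' x)) volume 0 1 :=
    hintegrable ((hCp.mul (hC'p.mul hp'c)).sub (hCq.mul (hC'q.mul hq'c)))
  have hsquares : ∫ x in (0 : ℝ)..1, (C (p x) * (deriv C (p x) * p' x)
      - C (q x) * (deriv C (q x) * q' x)) = 0 := by
    have hprim : ∀ x ∈ Ioo (0 : ℝ) 1, HasDerivAt (fun x => (C (p x) ^ 2 - C (q x) ^ 2) / 2)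
        (C (p x) * (deriv C (p x) * p' x) - C (q x) * (deriv C (q x) * q' x)) x := by
      intro x hx
      refine ((((hderiv hp x hx).pow 2).sub ((hderiv hq x hx).pow 2)).div_const 2).congr_deriv ?_
      push_cast
      ring
    have h := intervalIntegral.integral_eq_sub_of_hasDerivAt_of_le zero_le_one
      (((hCp.pow 2).sub (hCq.pow 2)).div_const 2) hprim hi3
    simpa [h0, h1] using h
  have hg0 : ∫ x in (0 : ℝ)..1, g x = 0 := by
    have hi1 : IntervalIntegrable (fun x => deriv C (p x) * C (q x) * p' x) volume 0 1 :=
      hintegrable ((hC'p.mul hCq).mul hp'c)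
    have hi2 : IntervalIntegrable (fun x => deriv C (q x) * C (p x) * q' x) volume 0 1 :=
      hintegrable ((hC'q.mul hCp).mul hq'c)
    have hsplit : ∫ x in (0 : ℝ)..1, g x =
        (∫ x in (0 : ℝ)..1, (C (p x) * (deriv C (p x) * p' x)
          - C (q x) * (deriv C (q x) * q' x)))
        - ((∫ x in (0 : ℝ)..1, deriv C (p x) * C (q x) * p' x)
          - ∫ x in (0 : ℝ)..1, deriv C (q x) * C (p x) * q' x) := by
      rw [← intervalIntegral.integral_sub hi1 hi2,
        ← intervalIntegral.integral_sub hi3 (hi1.sub hi2)]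
      refine intervalIntegral.integral_congr fun x _ => ?_
      simp only [g]
      ring
    rw [hsplit, hsquares, heq]
    ring
  have hgnonneg : ∀ x ∈ Icc (0 : ℝ) 1, 0 ≤ g x := by
    intro x hx
    have hzero : deriv C (p x) = 0 → deriv C (q x) = 0 → 0 ≤ g x := by
      intro h h'
      simp [g, h, h']
    rcases le_or_gt x s with hxs | hxs
    · exact hzero (hCl _ (hpm.monotoneOn hx hsm hxs))
        (hCl _ (hs ▸ hqm.monotoneOn hx hsm hxs))
    rcases le_or_gt t x with hxt | hxt
    · exact hzero (hCr _ (hpm.monotoneOn htm hx hxt))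
        (hCr _ (ht ▸ hqm.monotoneOn htm hx hxt))
    · exact mul_nonneg (sub_nonneg.2 (hCmono (hpq x ⟨hxs, hxt⟩).le))
        (add_nonneg (mul_nonneg (hC0 _) (hp'0 x)) (mul_nonneg (hC0 _) (hq'0 x)))
  have hgzero : ∀ x ∈ Icc (0 : ℝ) 1, g x = 0 := by
    by_contra! hex
    obtain ⟨x, hx, hgx⟩ := hex
    exact (intervalIntegral.integral_pos zero_lt_one hgc
      (fun y hy => hgnonneg y (Ioc_subset_Icc_self hy))
      ⟨x, hx, (hgnonneg x hx).lt_of_ne' hgx⟩).ne' hg0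
  have hp'zero : ∀ x ∈ Ioo s t, deriv p x = 0 := by
    intro x hx
    have hx01 : x ∈ Icc (0 : ℝ) 1 := ⟨hs0.trans hx.1.le, hx.2.le.trans ht1⟩
    have hpx : p x ∈ Ioo (p s) (p t) := ⟨hpm hsm hx01 hx.1, hpm hx01 htm hx.2⟩
    have hqx : q x ∈ Ioo (p s) (p t) :=
      ⟨hs ▸ hqm hsm hx01 hx.1, ht ▸ hqm hx01 htm hx.2⟩
    have hlt := hCstrict (Ioo_subset_Icc_self hqx) (Ioo_subset_Icc_self hpx) (hpq x hx)
    have hsum := (mul_eq_zero.1 (hgzero x hx01)).resolve_left (sub_pos.2 hlt).ne'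
    have hprod : deriv C (p x) * p' x = 0 :=
      ((add_eq_zero_iff_of_nonneg (mul_nonneg (hC0 _) (hp'0 x))
        (mul_nonneg (hC0 _) (hq'0 x))).1 hsum).1
    rw [← derivWithin_of_mem_nhds (Icc_mem_nhds (hs0.trans_lt hx.1) (hx.2.trans_le ht1))]
    exact (mul_eq_zero.1 hprod).resolve_left (hCpos _ hpx).ne'
  have hsub : Icc s t ⊆ Icc 0 1 := Icc_subset_Icc hs0 ht1
  obtain ⟨x, hx, hslope⟩ := exists_deriv_eq_slope p hst (hpc.mono hsub)
    (((hp.differentiableOn one_ne_zero).mono (Ioo_subset_Icc_self.trans hsub)))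
  rw [hp'zero x hx, eq_comm, div_eq_zero_iff] at hslope
  rcases hslope with h | h <;> linarith

lemma exists_contDiff_integral_ne_of_strictMonoOn {p q : ℝ → ℝ}
    (hp : ContDiffOn ℝ 1 p (Icc 0 1)) (hq : ContDiffOn ℝ 1 q (Icc 0 1))
    (hpm : StrictMonoOn p (Icc 0 1)) (hqm : StrictMonoOn q (Icc 0 1))
    (h0 : p 0 = q 0) (h1 : p 1 = q 1)
    {t₀ : ℝ} (ht₀ : t₀ ∈ Ioo (0 : ℝ) 1) (hne : p t₀ ≠ q t₀) :
    ∃ C : ℝ → ℝ, ContDiff ℝ 1 C ∧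
      ∫ t in (0 : ℝ)..1, deriv C (p t) * C (q t) * derivWithin p (Icc 0 1) t ≠
      ∫ t in (0 : ℝ)..1, deriv C (q t) * C (p t) * derivWithin q (Icc 0 1) t := by
  rcases hne.lt_or_gt with h | h
  · obtain ⟨C, hC, hne⟩ :=
      exists_contDiff_integral_ne_of_lt hq hp hqm hpm h0.symm h1.symm ht₀ h
    exact ⟨C, hC, hne.symm⟩
  · exact exists_contDiff_integral_ne_of_lt hp hq hpm hqm h0 h1 ht₀ h

lemma exists_contDiff_integral_ne {p q : ℝ → ℝ}
    (hp : ContDiffOn ℝ 1 p (Icc 0 1)) (hq : ContDiffOn ℝ 1 q (Icc 0 1))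
    (hpm : StrictMonoOn p (Icc 0 1) ∨ StrictAntiOn p (Icc 0 1))
    (hqm : StrictMonoOn q (Icc 0 1) ∨ StrictAntiOn q (Icc 0 1))
    (h0 : p 0 = q 0) (h1 : p 1 = q 1)
    {t₀ : ℝ} (ht₀ : t₀ ∈ Ioo (0 : ℝ) 1) (hne : p t₀ ≠ q t₀) :
    ∃ C : ℝ → ℝ, ContDiff ℝ 1 C ∧
      ∫ t in (0 : ℝ)..1, deriv C (p t) * C (q t) * derivWithin p (Icc 0 1) t ≠
      ∫ t in (0 : ℝ)..1, deriv C (q t) * C (p t) * derivWithin q (Icc 0 1) t := by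
  have hz : (0 : ℝ) ∈ Icc (0 : ℝ) 1 := ⟨le_rfl, zero_le_one⟩
  have ho : (1 : ℝ) ∈ Icc (0 : ℝ) 1 := ⟨zero_le_one, le_rfl⟩
  rcases hpm with hpm | hpm <;> rcases hqm with hqm | hqm
  · exact exists_contDiff_integral_ne_of_strictMonoOn hp hq hpm hqm h0 h1 ht₀ hne
  · linarith [hpm hz ho zero_lt_one, hqm hz ho zero_lt_one]
  · linarith [hpm hz ho zero_lt_one, hqm hz ho zero_lt_one]
  · obtain ⟨C, hC, hCne⟩ := exists_contDiff_integral_ne_of_strictMonoOn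
      (p := fun x => -p x) (q := fun x => -q x) hp.neg hq.neg hpm.neg hqm.neg
      (by simp [h0]) (by simp [h1]) ht₀ (by simpa using hne)
    refine ⟨fun x => C (-x), hC.comp contDiff_neg, ?_⟩
    simpa [derivWithin.fun_neg, deriv_comp_neg] using hCne

open Set MeasureTheory

/-- If a strictly monotonic continuously differentiable path `γ : [0,1] → (a,b)ⁿ` with
`γᵢ(0) = γⱼ(0)` and `γᵢ(1) = γⱼ(1)` leaves the diagonal at some `t₀ ∈ (0,1)`, then there
is a Lipschitz continuous function `F : (a,b)ⁿ → ℝ`, symmetric in `xᵢ, xⱼ` and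
differentiable at `γ t` for a.e. `t`, whose two line-integral attributions differ. -/
theorem off_diagonal_path_not_symmetry_preserving {n : ℕ} (i j : Fin n) (hij : i ≠ j)
    (a b : ℝ) (hab : a < b)
    (γ : ℝ → EuclideanSpace ℝ (Fin n))
    (hγbox : ∀ t ∈ Icc (0:ℝ) 1, ∀ k, γ t k ∈ Ioo a b)
    (hγ : ContDiffOn ℝ 1 γ (Icc (0:ℝ) 1))
    (hmono : ∀ k : Fin n, StrictMonoOn (fun t => γ t k) (Icc (0:ℝ) 1) ∨
      StrictAntiOn (fun t => γ t k) (Icc (0:ℝ) 1))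
    (h0 : γ 0 i = γ 0 j) (h1 : γ 1 i = γ 1 j)
    (t₀ : ℝ) (ht₀ : t₀ ∈ Ioo (0:ℝ) 1) (hne : γ t₀ i ≠ γ t₀ j) :
    ∃ F : EuclideanSpace ℝ (Fin n) → ℝ,
      (∃ K : NNReal, LipschitzOnWith K F {x : EuclideanSpace ℝ (Fin n) | ∀ k, x k ∈ Ioo a b}) ∧
      (∀ x : EuclideanSpace ℝ (Fin n), (∀ k, x k ∈ Ioo a b) →
        F (WithLp.toLp 2 (fun k => x (Equiv.swap i j k))) = F x) ∧
      (∀ᵐ t ∂(volume.restrict (Icc (0:ℝ) 1)), DifferentiableAt ℝ F (γ t)) ∧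
      ∫ t in (0:ℝ)..1,
          fderiv ℝ F (γ t) (EuclideanSpace.single i 1) * derivWithin (fun s => γ s i) (Icc (0:ℝ) 1) t
        ≠ ∫ t in (0:ℝ)..1,
          fderiv ℝ F (γ t) (EuclideanSpace.single j 1) * derivWithin (fun s => γ s j) (Icc (0:ℝ) 1) t := by
  have hcoord : ∀ k, ContDiffOn ℝ 1 (fun t => γ t k) (Icc (0 : ℝ) 1) := contDiffOn_euclidean.1 hγ
  obtain ⟨C, hC, hCne⟩ := exists_contDiff_integral_ne (hcoord i) (hcoord j) (hmono i) (hmono j)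
    h0 h1 ht₀ hne
  have hCd : Differentiable ℝ C := hC.differentiable one_ne_zero
  have hproj : ∀ k, ContDiff ℝ 1 (fun x : EuclideanSpace ℝ (Fin n) => x k) :=
    contDiff_euclidean.1 contDiff_id
  have hF : ContDiff ℝ 1 (fun x : EuclideanSpace ℝ (Fin n) => C (x i) * C (x j)) :=
    (hC.comp (hproj i)).mul (hC.comp (hproj j))
  have hfderiv : ∀ (x : EuclideanSpace ℝ (Fin n)) k,
      fderiv ℝ (fun x : EuclideanSpace ℝ (Fin n) => C (x i) * C (x j)) x
        (EuclideanSpace.single k 1) =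
      C (x i) * (deriv C (x j) * EuclideanSpace.single k (1 : ℝ) j) +
      C (x j) * (deriv C (x i) * EuclideanSpace.single k (1 : ℝ) i) := by
    intro x k
    have hcomp : ∀ l, HasFDerivAt (fun x : EuclideanSpace ℝ (Fin n) => C (x l))
        (deriv C (x l) • EuclideanSpace.proj (𝕜 := ℝ) l) x := fun l =>
      (hCd (x l)).hasDerivAt.comp_hasFDerivAt x
        (EuclideanSpace.proj (𝕜 := ℝ) l : EuclideanSpace ℝ (Fin n) →L[ℝ] ℝ).hasFDerivAt
    have h := ((hcomp i).mul (hcomp j)).fderiv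
    simp only [Pi.mul_def] at h
    rw [h]
    simp
  refine ⟨fun x => C (x i) * C (x j), ?_, ?_, ?_, ?_⟩
  · have hbox : Convex ℝ {x : EuclideanSpace ℝ (Fin n) | ∀ k, x k ∈ Icc a b} := by
      intro x hx y hy s t hs ht hst k
      exact convex_Icc a b (hx k) (hy k) hs ht hst
    have hcompact : IsCompact {x : EuclideanSpace ℝ (Fin n) | ∀ k, x k ∈ Icc a b} := by
      have h := (isCompact_univ_pi fun _ : Fin n => isCompact_Icc (a := a) (b := b)).image
        (PiLp.continuous_toLp 2 fun _ : Fin n => ℝ)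
      convert h using 1
      ext x
      exact ⟨fun hx => ⟨x.ofLp, fun k _ => hx k, rfl⟩,
        by rintro ⟨y, hy, rfl⟩ k; exact hy k (mem_univ k)⟩
    obtain ⟨K, hK⟩ := hF.contDiffOn.exists_lipschitzOnWith one_ne_zero hbox hcompact
    exact ⟨K, hK.mono fun x hx k => Ioo_subset_Icc_self (hx k)⟩
  · intro x _
    simp [mul_comm]
  · exact Filter.Eventually.of_forall fun t => hF.differentiable one_ne_zero _
  · have hji := hij.symm
    simp only [hfderiv]
    simpa [hij, hji, mul_comm, mul_left_comm, mul_assoc] using hCne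
end

section
/- Let i ≠ j be indices in {1,…,n}, let U ⊆ ℝⁿ be open, and let p, q ∈ U with pᵢ = pⱼ and qᵢ = qⱼ. Let γ(t) = p + t(q − p) be the straight-line path from p to q, assumed to lie in U. Then for every Lipschitz continuous function F : U → ℝ that is symmetric in xᵢ and xⱼ and differentiable at γ(t) for almost every t ∈ [0,1], one has ∫₀¹ (∂F/∂xᵢ)(γ(t)) γᵢ′(t) dt = ∫₀¹ (∂F/∂xⱼ)(γ(t)) γⱼ′(t) dt; that is, the straight-line path is IG-symmetry preserving for variables xᵢ and xⱼ. -/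
open Set MeasureTheory

open scoped Topology

theorem piLpCongrLeft_swap_apply_of_eq {ι : Type*} [Fintype ι] [DecidableEq ι]
    {x : EuclideanSpace ℝ ι} {i j : ι} (hx : x i = x j) :
    LinearIsometryEquiv.piLpCongrLeft 2 ℝ ℝ (Equiv.swap i j) x = x := by
  ext k
  change x ((Equiv.swap i j).symm k) = x k
  rw [Equiv.symm_swap]
  rcases eq_or_ne k i with rfl | hi
  · rw [Equiv.swap_apply_left, hx]
  rcases eq_or_ne k j with rfl | hj
  · rw [Equiv.swap_apply_right, hx]
  rw [Equiv.swap_apply_of_ne_of_ne hi hj]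

/-- At a point fixed by the transposition of two coordinates, the two corresponding partial
derivatives of a locally symmetric function coincide. -/
theorem fderiv_single_eq_of_eventually_symmetric {ι : Type*} [Fintype ι] [DecidableEq ι]
    {F : EuclideanSpace ℝ ι → ℝ} {x : EuclideanSpace ℝ ι} {i j : ι} (hx : x i = x j)
    (hF : ∀ᶠ y in 𝓝 x,
      F (LinearIsometryEquiv.piLpCongrLeft 2 ℝ ℝ (Equiv.swap i j) y) = F y) :
    fderiv ℝ F x (EuclideanSpace.single i 1) = fderiv ℝ F x (EuclideanSpace.single j 1) := by
  let e := (LinearIsometryEquiv.piLpCongrLeft 2 ℝ ℝ (Equiv.swap i j)).toContinuousLinearEquiv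
  have hex : e x = x := piLpCongrLeft_swap_apply_of_eq hx
  have hei : e (EuclideanSpace.single i 1) = EuclideanSpace.single j 1 := by
    refine (LinearIsometryEquiv.piLpCongrLeft_single (Equiv.swap i j) i (1 : ℝ)).trans ?_
    rw [Equiv.swap_apply_left]
  have hcomp : F ∘ e =ᶠ[𝓝 x] F := hF
  calc fderiv ℝ F x (EuclideanSpace.single i 1)
      = fderiv ℝ (F ∘ e) x (EuclideanSpace.single i 1) := by rw [hcomp.fderiv_eq]
    _ = fderiv ℝ F (e x) (e (EuclideanSpace.single i 1)) := by
        rw [e.comp_right_fderiv]; rfl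
    _ = fderiv ℝ F x (EuclideanSpace.single j 1) := by rw [hex, hei]

/-- **Straight-line paths are IG-symmetry preserving.**
Let `U ⊆ ℝⁿ` be open, `p, q ∈ U` with `pᵢ = pⱼ` and `qᵢ = qⱼ`, and suppose the
straight-line path `γ(t) = p + t(q - p)` lies in `U`.  Then for every Lipschitz
continuous `F : U → ℝ` symmetric in `xᵢ, xⱼ` and differentiable at `γ t` for a.e. `t`,
`∫₀¹ (∂F/∂xᵢ)(γ(t)) γᵢ'(t) dt = ∫₀¹ (∂F/∂xⱼ)(γ(t)) γⱼ'(t) dt`. -/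
theorem straight_line_symmetry_preserving {n : ℕ} (i j : Fin n) (hij : i ≠ j)
    (U : Set (EuclideanSpace ℝ (Fin n))) (hU : IsOpen U)
    (p q : EuclideanSpace ℝ (Fin n)) (hp : p ∈ U) (hq : q ∈ U)
    (hpij : p i = p j) (hqij : q i = q j)
    (hline : ∀ t ∈ Icc (0:ℝ) 1, p + t • (q - p) ∈ U) :
    ∀ F : EuclideanSpace ℝ (Fin n) → ℝ,
      (∃ K : NNReal, LipschitzOnWith K F U) →
      (∀ x : EuclideanSpace ℝ (Fin n), x ∈ U →
        (WithLp.toLp 2 (fun k => x (Equiv.swap i j k)) : EuclideanSpace ℝ (Fin n)) ∈ U →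
        F (WithLp.toLp 2 (fun k => x (Equiv.swap i j k))) = F x) →
      (∀ᵐ t ∂(volume.restrict (Icc (0:ℝ) 1)),
        DifferentiableAt ℝ F (p + t • (q - p))) →
      ∫ t in (0:ℝ)..1,
          fderiv ℝ F (p + t • (q - p)) (EuclideanSpace.single i 1)
            * derivWithin (fun s => (p + s • (q - p)) i) (Icc (0:ℝ) 1) t
        = ∫ t in (0:ℝ)..1,
          fderiv ℝ F (p + t • (q - p)) (EuclideanSpace.single j 1)
            * derivWithin (fun s => (p + s • (q - p)) j) (Icc (0:ℝ) 1) t := by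
  intro F _ hsymm _
  have hcoord : ∀ s : ℝ, (p + s • (q - p)) i = (p + s • (q - p)) j := by
    intro s
    simp [hpij, hqij]
  refine intervalIntegral.integral_congr fun t ht => ?_
  rw [uIcc_of_le zero_le_one] at ht
  let e := LinearIsometryEquiv.piLpCongrLeft 2 ℝ ℝ (Equiv.swap i j)
  have hfix : e (p + t • (q - p)) = p + t • (q - p) :=
    piLpCongrLeft_swap_apply_of_eq (hcoord t)
  have hU₁ : U ∈ 𝓝 (p + t • (q - p)) := hU.mem_nhds (hline t ht)
  have hU₂ : ∀ᶠ y in 𝓝 (p + t • (q - p)), e y ∈ U :=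
    e.continuous.continuousAt.eventually_mem (by rwa [hfix])
  have hfderiv := fderiv_single_eq_of_eventually_symmetric (F := F) (hcoord t) (by
    filter_upwards [hU₁, hU₂] with y hy hey
    exact hsymm y hy hey)
  simp only [hfderiv, hcoord]
end
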